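/- arXiv:1108.0142 — 2 statements merged into one kernel-verified Lean document; each statement's English description precedes it below -/
import Mathlib

section
/- Let I be infinite, 1 < p < ∞, and T a bounded linear operator on ℓᵖ(I) that preserves majorization. Then for each i ∈ I there is at most one j ∈ I with (Te_j)(i) ≠ 0. -/
open scoped ENNReal

/-- The standard basis element `e i` of `ℓᵖ(I)`. -/
noncomputable def stdb (p : ℝ≥0∞) {I : Type*} (i : I) : lp (fun _ : I => ℝ) p :=
  letI := Classical.decEq I
  lp.single p i 1

/-- A bounded linear operator `A : ℓᵖ(J) → ℓᵖ(I)` is positive if `A f ≥ 0` whenever `f ≥ 0`. -/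
def IsPositiveOp {I J : Type*} {p : ℝ≥0∞} [Fact (1 ≤ p)]
    (A : lp (fun _ : J => ℝ) p →L[ℝ] lp (fun _ : I => ℝ) p) : Prop :=
  ∀ f : lp (fun _ : J => ℝ) p, (∀ j, 0 ≤ f j) → ∀ i, 0 ≤ A f i

/-- Row stochastic: positive and each row sum `∑_j ⟨A e_j, e_i⟩` equals 1. -/
def IsRowStochastic {I J : Type*} {p : ℝ≥0∞} [Fact (1 ≤ p)]
    (A : lp (fun _ : J => ℝ) p →L[ℝ] lp (fun _ : I => ℝ) p) : Prop :=
  IsPositiveOp A ∧ ∀ i : I, HasSum (fun j : J => A (stdb p j) i) 1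

/-- Column stochastic: positive and each column sum `∑_i ⟨A e_j, e_i⟩` equals 1. -/
def IsColumnStochastic {I J : Type*} {p : ℝ≥0∞} [Fact (1 ≤ p)]
    (A : lp (fun _ : J => ℝ) p →L[ℝ] lp (fun _ : I => ℝ) p) : Prop :=
  IsPositiveOp A ∧ ∀ j : J, HasSum (fun i : I => A (stdb p j) i) 1

/-- Doubly stochastic: both row and column stochastic. -/
def IsDoublyStochastic {I J : Type*} {p : ℝ≥0∞} [Fact (1 ≤ p)]
    (A : lp (fun _ : J => ℝ) p →L[ℝ] lp (fun _ : I => ℝ) p) : Prop :=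
  IsRowStochastic A ∧ IsColumnStochastic A

/-- `f ≺ g` : `f` is majorized by `g`, i.e. `f = D g` for some doubly stochastic `D`. -/
def Majorized {I : Type*} {p : ℝ≥0∞} [Fact (1 ≤ p)]
    (f g : lp (fun _ : I => ℝ) p) : Prop :=
  ∃ D : lp (fun _ : I => ℝ) p →L[ℝ] lp (fun _ : I => ℝ) p,
    IsDoublyStochastic D ∧ f = D g

/-- `T` preserves majorization if `f ≺ g` implies `T f ≺ T g`. -/
def PreservesMajorization {I : Type*} {p : ℝ≥0∞} [Fact (1 ≤ p)]
    (T : lp (fun _ : I => ℝ) p →L[ℝ] lp (fun _ : I => ℝ) p) : Prop :=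
  ∀ f g : lp (fun _ : I => ℝ) p, Majorized f g → Majorized (T f) (T g)

open Filter Topology

theorem aux_stdb_apply {I : Type*} [DecidableEq I] (p : ℝ≥0∞) (i j : I) :
    (stdb p i : lp (fun _ : I => ℝ) p) j = if j = i then 1 else 0 := by
  unfold stdb
  by_cases h : j = i
  · subst h; simp
  · rw [if_neg h]
    exact @lp.single_apply_ne I (fun _ : I => ℝ) _ (Classical.decEq I) p i 1 j h

theorem aux_toReal_pos (p : ℝ≥0∞) [hF : Fact (1 ≤ p)] (hp2 : p ≠ ∞) : 0 < p.toReal :=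
  ENNReal.toReal_pos (zero_lt_one.trans_le hF.out).ne' hp2

theorem aux_tendsto {I : Type*} {p : ℝ≥0∞} [Fact (1 ≤ p)] (hp2 : p ≠ ∞)
    (f : lp (fun _ : I => ℝ) p) : Tendsto (fun i => f i) cofinite (𝓝 0) := by
  have hp := aux_toReal_pos p hp2
  have h1 := ((lp.memℓp f).summable hp).tendsto_cofinite_zero
  have h2 := h1.rpow_const (p := 1 / p.toReal) (Or.inr (by positivity))
  rw [Real.zero_rpow (by positivity)] at h2
  rw [tendsto_zero_iff_norm_tendsto_zero]
  refine h2.congr fun i => ?_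
  rw [← Real.rpow_mul (norm_nonneg _), mul_one_div_cancel hp.ne', Real.rpow_one]

theorem aux_fin {I : Type*} {p : ℝ≥0∞} [Fact (1 ≤ p)] (hp2 : p ≠ ∞)
    (f : lp (fun _ : I => ℝ) p) {ε : ℝ} (hε : 0 < ε) : {i | ε ≤ |f i|}.Finite := by
  have := (Metric.tendsto_nhds.1 (aux_tendsto hp2 f)) ε hε
  rw [eventually_cofinite] at this
  refine this.subset fun i hi => ?_
  simpa using hi

theorem aux_countable {I : Type*} {p : ℝ≥0∞} [Fact (1 ≤ p)] (hp2 : p ≠ ∞)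
    (f : lp (fun _ : I => ℝ) p) : (insert 0 (Set.range (fun i => f i)) : Set ℝ).Countable := by
  have : (insert 0 (Set.range (fun i => f i)) : Set ℝ) ⊆
      {0} ∪ ⋃ n : ℕ, (fun i => f i) '' {i | (1 : ℝ) / (n + 1) ≤ |f i|} := by
    rintro v (rfl | ⟨i, rfl⟩)
    · simp
    · by_cases h : f i = 0
      · left; exact h
      · right
        obtain ⟨n, hn⟩ := exists_nat_one_div_lt (abs_pos.2 h)
        exact Set.mem_iUnion.2 ⟨n, i, hn.le, rfl⟩
  refine Set.Countable.mono this ?_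
  refine (Set.countable_singleton _).union (Set.countable_iUnion fun n => ?_)
  exact ((aux_fin hp2 f (by positivity)).image _).countable

theorem aux_compact {I : Type*} {p : ℝ≥0∞} [Fact (1 ≤ p)] (hp2 : p ≠ ∞)
    (f : lp (fun _ : I => ℝ) p) : IsCompact (insert 0 (Set.range (fun i => f i)) : Set ℝ) :=
  (aux_tendsto hp2 f).isCompact_insert_range_of_cofinite

theorem aux_supp {I : Type*} {p : ℝ≥0∞} [Fact (1 ≤ p)] (hp2 : p ≠ ∞)
    (f : lp (fun _ : I => ℝ) p) {c : ℝ} (hc : 0 < c) :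
    (Function.support (fun i => max (f i - c) 0)).Finite := by
  refine (aux_fin hp2 f hc).subset fun i hi => ?_
  by_contra h
  apply hi
  have h' : |f i| < c := by simpa using h
  have := (abs_lt.1 h').2
  exact max_eq_right (by linarith)

theorem aux_summable {I : Type*} {p : ℝ≥0∞} [Fact (1 ≤ p)] (hp2 : p ≠ ∞)
    (f : lp (fun _ : I => ℝ) p) {c : ℝ} (hc : 0 < c) :
    Summable (fun i => max (f i - c) 0) :=
  summable_of_hasFiniteSupport (aux_supp hp2 f hc)

theorem aux_single {I : Type*} {p : ℝ≥0∞} (i : I) (a : ℝ) :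
    (letI := Classical.decEq I; (lp.single p i a : lp (fun _ : I => ℝ) p)) = a • stdb p i := by
  classical
  ext j
  by_cases h : j = i
  · subst h; simp [stdb]
  · rw [lp.single_apply_ne (E := fun _ : I => ℝ) p i a h, lp.coeFn_smul, Pi.smul_apply,
      aux_stdb_apply, if_neg h, smul_zero]

theorem aux_expand {I : Type*} {p : ℝ≥0∞} [Fact (1 ≤ p)] (hp2 : p ≠ ∞)
    (D : lp (fun _ : I => ℝ) p →L[ℝ] lp (fun _ : I => ℝ) p) (g : lp (fun _ : I => ℝ) p) (i : I) :
    HasSum (fun j => D (stdb p j) i * g j) (D g i) := by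
  classical
  have h := lp.hasSum_single hp2 g
  have h2 := h.mapL ((lp.evalCLM ℝ (fun _ : I => ℝ) p i).comp D)
  have hfun : (fun j => D (stdb p j) i * g j) = fun j =>
      ((lp.evalCLM ℝ (fun _ : I => ℝ) p i).comp D) (lp.single p j (g j)) := by
    funext j
    have := aux_single (p := p) j (g j)
    have h3 : (lp.single p j (g j) : lp (fun _ : I => ℝ) p) = g j • stdb p j := by
      rw [← this]
    rw [h3, map_smul]
    simp only [ContinuousLinearMap.comp_apply, smul_eq_mul]
    rw [mul_comm]; rfl
  rw [hfun]
  exact h2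

theorem aux_phi_le {I : Type*} {p : ℝ≥0∞} [Fact (1 ≤ p)] (hp2 : p ≠ ∞)
    {f g : lp (fun _ : I => ℝ) p} (h : Majorized f g) {c : ℝ} (hc : 0 < c) :
    ∑' i, max (f i - c) 0 ≤ ∑' i, max (g i - c) 0 := by
  classical
  obtain ⟨D, ⟨⟨hpos, hrow⟩, -, hcol⟩, rfl⟩ := h
  have hD : ∀ j i, 0 ≤ D (stdb p j) i := fun j i =>
    hpos _ (fun k => by rw [aux_stdb_apply]; split_ifs <;> norm_num) i
  set G := (aux_supp hp2 g hc).toFinset with hG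
  have hG0 : ∀ j ∉ G, max (g j - c) 0 = 0 := by
    intro j hj
    simpa [hG] using hj
  have key : ∀ i, max (D g i - c) 0 ≤ ∑ j ∈ G, D (stdb p j) i * max (g j - c) 0 := by
    intro i
    have h1 := (aux_expand hp2 D g i).sub ((hrow i).mul_right c)
    have h2 : HasSum (fun j => D (stdb p j) i * max (g j - c) 0)
        (∑ j ∈ G, D (stdb p j) i * max (g j - c) 0) :=
      hasSum_sum_of_ne_finset_zero fun j hj => by rw [hG0 j hj, mul_zero]
    have h3 := hasSum_le (fun j => by
      have := mul_le_mul_of_nonneg_left (le_max_left (g j - c) 0) (hD j i)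
      rw [mul_sub] at this
      exact this) h1 h2
    refine max_le (by linarith) (Finset.sum_nonneg fun j _ => mul_nonneg (hD j i) (le_max_right _ _))
  rw [tsum_eq_sum hG0]
  have h4 : HasSum (fun i => ∑ j ∈ G, D (stdb p j) i * max (g j - c) 0)
      (∑ j ∈ G, 1 * max (g j - c) 0) :=
    hasSum_sum fun j _ => (hcol j).mul_right _
  simp only [one_mul] at h4
  exact hasSum_le key (aux_summable hp2 _ hc).hasSum h4

theorem aux_near {I : Type*} {p : ℝ≥0∞} [Fact (1 ≤ p)] (hp2 : p ≠ ∞)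
    {f g : lp (fun _ : I => ℝ) p} (h : Majorized f g) (h' : Majorized g f) (i : I)
    (hi : 0 < f i) {ε : ℝ} (hε : 0 < ε) (hε' : ε < f i) : ∃ m, |f i - g m| < ε := by
  set v := f i with hv
  have heq : ∀ c, 0 < c → ∑' i, max (f i - c) 0 = ∑' i, max (g i - c) 0 := fun c hc =>
    le_antisymm (aux_phi_le hp2 h hc) (aux_phi_le hp2 h' hc)
  have h1 : 0 < v - ε := by linarith
  have h2 : 0 < v + ε := by linarith
  have hs : ∀ u : lp (fun _ : I => ℝ) p, HasSum
      (fun i => max (u i - (v - ε)) 0 + max (u i - (v + ε)) 0 - 2 * max (u i - v) 0)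
      (∑' i, max (u i - (v - ε)) 0 + ∑' i, max (u i - (v + ε)) 0 - 2 * ∑' i, max (u i - v) 0) :=
    fun u => ((aux_summable hp2 u h1).hasSum.add (aux_summable hp2 u h2).hasSum).sub
      ((aux_summable hp2 u hi).hasSum.mul_left 2)
  by_contra hcon
  push Not at hcon
  have hg0 : ∀ m, max (g m - (v - ε)) 0 + max (g m - (v + ε)) 0 - 2 * max (g m - v) 0 = 0 := by
    intro m
    rcases le_abs.1 (hcon m) with h | h
    · rw [max_eq_right (by linarith), max_eq_right (by linarith), max_eq_right (by linarith)]; ring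
    · rw [max_eq_left (by linarith), max_eq_left (by linarith), max_eq_left (by linarith)]; ring
  have hG := hs g
  simp only [hg0] at hG
  have hG' := hG.unique hasSum_zero
  have hFs := hs f
  rw [heq _ h1, heq _ h2, heq _ hi, hG'] at hFs
  have hnn : ∀ m, 0 ≤ max (f m - (v - ε)) 0 + max (f m - (v + ε)) 0 - 2 * max (f m - v) 0 := by
    intro m
    have a1 := le_max_left (f m - (v - ε)) 0
    have a2 := le_max_right (f m - (v - ε)) 0
    have a3 := le_max_left (f m - (v + ε)) 0
    have a4 := le_max_right (f m - (v + ε)) 0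
    rcases max_cases (f m - v) 0 with h | h <;> linarith [h.1]
  have := (hasSum_zero_iff_of_nonneg hnn).1 hFs
  have := congrFun this i
  simp only [Pi.zero_apply, ← hv] at this
  rw [max_eq_left (by linarith), max_eq_right (by linarith), max_eq_right (by linarith)] at this
  linarith

theorem aux_maj_neg {I : Type*} {p : ℝ≥0∞} [Fact (1 ≤ p)]
    {f g : lp (fun _ : I => ℝ) p} (h : Majorized f g) : Majorized (-f) (-g) := by
  obtain ⟨D, hD, rfl⟩ := h
  exact ⟨D, hD, by simp⟩

theorem aux_range_pos {I : Type*} {p : ℝ≥0∞} [Fact (1 ≤ p)] (hp2 : p ≠ ∞)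
    {f g : lp (fun _ : I => ℝ) p} (h : Majorized f g) (h' : Majorized g f) (i : I)
    (hi : 0 < f i) : f i ∈ (insert 0 (Set.range (fun i => g i)) : Set ℝ) := by
  rw [← (aux_compact hp2 g).isClosed.closure_eq, Metric.mem_closure_iff]
  intro ε hε
  obtain ⟨m, hm⟩ := aux_near hp2 h h' i hi (ε := min ε (f i / 2)) (by positivity)
    (by have := min_le_right ε (f i / 2); linarith)
  exact ⟨g m, Or.inr ⟨m, rfl⟩, by rw [Real.dist_eq]; exact hm.trans_le (min_le_left _ _)⟩

theorem aux_range {I : Type*} {p : ℝ≥0∞} [Fact (1 ≤ p)] (hp2 : p ≠ ∞)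
    {f g : lp (fun _ : I => ℝ) p} (h : Majorized f g) (h' : Majorized g f) (i : I) :
    f i ∈ (insert 0 (Set.range (fun i => g i)) : Set ℝ) := by
  rcases lt_trichotomy (f i) 0 with hi | hi | hi
  · have := aux_range_pos hp2 (aux_maj_neg h) (aux_maj_neg h') i
      (by rw [lp.coeFn_neg, Pi.neg_apply]; linarith)
    change -(f i) ∈ (insert 0 (Set.range (fun i => -(g i))) : Set ℝ) at this
    rcases this with h0 | ⟨m, hm⟩
    · left; linarith
    · right
      refine ⟨m, ?_⟩
      simp only at hm ⊢
      linarith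
  · left; exact hi
  · exact aux_range_pos hp2 h h' i hi

/-- The operator exchanging coordinates `k` and `l`. -/
noncomputable def auxSwap {I : Type*} (p : ℝ≥0∞) [Fact (1 ≤ p)] (k l : I) :
    lp (fun _ : I => ℝ) p →L[ℝ] lp (fun _ : I => ℝ) p :=
  ContinuousLinearMap.id ℝ _ +
    (lp.evalCLM ℝ (fun _ : I => ℝ) p l - lp.evalCLM ℝ (fun _ : I => ℝ) p k).smulRight
      (stdb p k - stdb p l)

theorem auxSwap_apply {I : Type*} [DecidableEq I] (p : ℝ≥0∞) [Fact (1 ≤ p)] (k l : I)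
    (f : lp (fun _ : I => ℝ) p) (i : I) : auxSwap p k l f i = f (Equiv.swap k l i) := by
  have : auxSwap p k l f i = f i + (f l - f k) * ((stdb p k : lp (fun _ : I => ℝ) p) i
    - (stdb p l : lp (fun _ : I => ℝ) p) i) := rfl
  rw [this, aux_stdb_apply, aux_stdb_apply]
  by_cases h1 : i = k
  · subst h1
    by_cases h2 : i = l
    · subst h2; simp
    · simp [h2]
  · by_cases h2 : i = l
    · subst h2; simp [h1]
    · simp [h1, h2, Equiv.swap_apply_of_ne_of_ne]

theorem auxSwap_ds {I : Type*} (p : ℝ≥0∞) [Fact (1 ≤ p)] (k l : I) :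
    IsDoublyStochastic (auxSwap p k l) := by
  classical
  have hpos : IsPositiveOp (auxSwap p k l) := fun f hf i => by
    rw [auxSwap_apply]; exact hf _
  refine ⟨⟨hpos, fun i => ?_⟩, hpos, fun j => ?_⟩
  · simp only [auxSwap_apply, aux_stdb_apply]
    convert hasSum_ite_eq (Equiv.swap k l i) (1 : ℝ) using 2 with j
    simp [eq_comm]
  · simp only [auxSwap_apply, aux_stdb_apply]
    convert hasSum_ite_eq (Equiv.swap k l j) (1 : ℝ) using 2 with i
    congr 1
    rw [Equiv.swap_apply_eq_iff]

theorem auxSwap_stdb {I : Type*} [DecidableEq I] (p : ℝ≥0∞) [Fact (1 ≤ p)] (k l j : I) :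
    auxSwap p k l (stdb p j) = stdb p (Equiv.swap k l j) := by
  ext i
  rw [auxSwap_apply, aux_stdb_apply, aux_stdb_apply]
  congr 1
  rw [Equiv.swap_apply_eq_iff]

theorem aux_maj {I : Type*} (p : ℝ≥0∞) [Fact (1 ≤ p)] (j k l : I) (hk : k ≠ j) (hl : l ≠ j)
    (α β : ℝ) : Majorized (α • stdb p j + β • stdb p l) (α • stdb p j + β • stdb p k) := by
  classical
  refine ⟨auxSwap p k l, auxSwap_ds p k l, ?_⟩
  rw [map_add, map_smul, map_smul, auxSwap_stdb, auxSwap_stdb, Equiv.swap_apply_left,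
    Equiv.swap_apply_of_ne_of_ne hk.symm hl.symm]

theorem aux_maj_stdb {I : Type*} (p : ℝ≥0∞) [Fact (1 ≤ p)] (k l : I) :
    Majorized (stdb p l) (stdb p k) := by
  classical
  refine ⟨auxSwap p k l, auxSwap_ds p k l, ?_⟩
  rw [auxSwap_stdb, Equiv.swap_apply_left]

theorem aux_weak {I : Type*} {p : ℝ≥0∞} [Fact (1 ≤ p)] (hp1 : 1 < p) (hp2 : p ≠ ∞)
    (φ : lp (fun _ : I => ℝ) p →L[ℝ] ℝ) {δ : ℝ} (hδ : 0 < δ) :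
    {k | δ ≤ |φ (stdb p k)|}.Finite := by
  classical
  by_contra hinf
  have hinf : {k | δ ≤ |φ (stdb p k)|}.Infinite := hinf
  have hp := aux_toReal_pos p hp2
  have hp1' : 1 < p.toReal := by
    rw [← ENNReal.toReal_one]; exact (ENNReal.toReal_lt_toReal (by simp) hp2).2 hp1
  have bound : ∀ N : ℕ, (N : ℝ) * δ ≤ ‖φ‖ * (N : ℝ) ^ (1 / p.toReal) := by
    intro N
    obtain ⟨S, hS, hcard⟩ := hinf.exists_subset_card_eq N
    set s : I → ℝ := fun k => if 0 ≤ φ (stdb p k) then 1 else -1 with hs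
    set u : lp (fun _ : I => ℝ) p := ∑ k ∈ S, s k • stdb p k with hu
    have hsn : ∀ k, ‖s k‖ = 1 := by intro k; simp only [hs]; split_ifs <;> simp
    have hun : ‖u‖ = (N : ℝ) ^ (1 / p.toReal) := by
      have h1 : u = ∑ k ∈ S, lp.single p k (s k) := by
        refine Finset.sum_congr rfl fun k _ => ?_
        rw [← aux_single]
      have h2 := lp.norm_sum_single (E := fun _ : I => ℝ) hp s S
      rw [← h1] at h2
      simp only [hsn, Real.one_rpow, Finset.sum_const, hcard, nsmul_eq_mul, mul_one] at h2
      rw [← h2, ← Real.rpow_mul (norm_nonneg _), mul_one_div_cancel hp.ne', Real.rpow_one]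
    have hφ : φ u = ∑ k ∈ S, |φ (stdb p k)| := by
      rw [hu, map_sum]
      refine Finset.sum_congr rfl fun k _ => ?_
      rw [map_smul, smul_eq_mul]
      simp only [hs]
      split_ifs with h
      · rw [abs_of_nonneg h, one_mul]
      · rw [abs_of_neg (not_le.1 h)]; ring
    have h3 : (N : ℝ) * δ ≤ φ u := by
      rw [hφ, ← hcard, ← nsmul_eq_mul]
      exact Finset.card_nsmul_le_sum _ _ _ fun k hk => hS hk
    calc (N : ℝ) * δ ≤ φ u := h3
      _ ≤ ‖φ u‖ := le_abs_self _
      _ ≤ ‖φ‖ * ‖u‖ := φ.le_opNorm u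
      _ = _ := by rw [hun]
  have hexp : 0 < 1 - 1 / p.toReal := by
    rw [sub_pos, div_lt_one hp]; exact hp1'
  have ht := (tendsto_rpow_atTop hexp).comp (tendsto_natCast_atTop_atTop (R := ℝ))
  obtain ⟨N, hN, hN1⟩ := ((ht.eventually_gt_atTop (‖φ‖ / δ)).and (eventually_ge_atTop 1)).exists
  have hNpos : (0 : ℝ) < N := by exact_mod_cast hN1
  have hb := bound N
  simp only [Function.comp] at hN
  rw [Real.rpow_sub hNpos, Real.rpow_one, div_lt_div_iff₀ hδ (by positivity)] at hN
  linarith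

/-- If `I` is infinite, `1 < p < ∞` and `T` preserves majorization on `ℓᵖ(I)`, then each row
of `T` has at most one nonzero entry. -/
theorem stmt18 {I : Type*} [Infinite I] (p : ℝ≥0∞) [Fact (1 ≤ p)] (hp1 : 1 < p) (hp2 : p ≠ ∞)
    (T : lp (fun _ : I => ℝ) p →L[ℝ] lp (fun _ : I => ℝ) p)
    (hT : PreservesMajorization T) :
    ∀ i : I, ∀ j₁ j₂ : I, T (stdb p j₁) i ≠ 0 → T (stdb p j₂) i ≠ 0 → j₁ = j₂ := by
  intro i j₁ j₂ ha hb
  by_contra hne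
  set x := T (stdb p j₁) with hx
  set a := x i with haa
  set b := T (stdb p j₂) i with hbb
  set V : Set ℝ := insert 0 (Set.range (fun i => x i)) with hV
  have hVc : IsCompact V := aux_compact hp2 x
  have hy : ∀ k m, T (stdb p k) m ∈ V := fun k m =>
    aux_range hp2 (hT _ _ (aux_maj_stdb p j₁ k)) (hT _ _ (aux_maj_stdb p k j₁)) m
  have claim : ∀ β : ℝ, a + β * b ∈ V ∪ (fun w => β * w) '' V := by
    intro β
    have hcl : IsClosed (V ∪ (fun w => β * w) '' V) :=
      (hVc.union (hVc.image (continuous_const_mul β))).isClosed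
    rw [← hcl.closure_eq, Metric.mem_closure_iff]
    intro ε hε
    have hF := aux_fin hp2 x hε
    set δ := ε / (|β| + 1) with hδ
    have hδ0 : 0 < δ := by positivity
    have hbad : (⋃ m ∈ {m | ε ≤ |x m|}, {k | δ ≤ |T (stdb p k) m|}).Finite :=
      hF.biUnion fun m _ =>
        aux_weak hp1 hp2 ((lp.evalCLM ℝ (fun _ : I => ℝ) p m).comp T) hδ0
    obtain ⟨k, hk⟩ := (hbad.union (Set.finite_singleton j₁)).infinite_compl.nonempty
    simp only [Set.mem_compl_iff, Set.mem_union, Set.mem_iUnion, Set.mem_ofPred_eq,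
      Set.mem_singleton_iff, not_or, not_exists, not_le] at hk
    obtain ⟨hk1, hk2⟩ := hk
    have hval : ∀ l m, T ((1 : ℝ) • stdb p j₁ + β • stdb p l) m = x m + β * T (stdb p l) m := by
      intro l m
      rw [map_add, map_smul, map_smul, one_smul]; rfl
    have hr := aux_range hp2 (hT _ _ (aux_maj p j₁ k j₂ hk2 (Ne.symm hne) 1 β))
      (hT _ _ (aux_maj p j₁ j₂ k (Ne.symm hne) hk2 1 β)) i
    simp only [hval] at hr
    rcases hr with h0 | ⟨m, hm⟩
    · exact ⟨0, Or.inl (Or.inl rfl), by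
        rw [Real.dist_eq, h0]; simpa using hε⟩
    · have hm' : x m + β * T (stdb p k) m = a + β * b := hm
      by_cases hmF : ε ≤ |x m|
      · refine ⟨x m, Or.inl (Or.inr ⟨m, rfl⟩), ?_⟩
        rw [Real.dist_eq, ← hm', add_sub_cancel_left, abs_mul]
        have h1 := hk1 m hmF
        calc |β| * |T (stdb p k) m| ≤ |β| * δ := by gcongr
          _ < (|β| + 1) * δ := by linarith
          _ = ε := by rw [hδ]; field_simp
      · refine ⟨β * T (stdb p k) m, Or.inr ⟨_, hy k m, rfl⟩, ?_⟩
        rw [Real.dist_eq, ← hm', add_sub_cancel_right]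
        exact not_le.1 hmF
  have hcount : V.Countable := aux_countable hp2 x
  have hsub : (Set.univ : Set ℝ) ⊆ (fun v => (v - a) / b) '' V ∪ (fun v => a / (v - b)) '' V := by
    intro β _
    rcases claim β with h | ⟨w, hw, h⟩
    · left
      refine ⟨_, h, ?_⟩
      simp only; field_simp; ring
    · right
      refine ⟨w, hw, ?_⟩
      simp only at h ⊢
      have h1 : β * (w - b) = a := by linarith
      have h2 : w - b ≠ 0 := by
        intro h3; rw [h3, mul_zero] at h1; exact ha h1.symm
      rw [← h1]; field_simp
  exact Cardinal.not_countable_real (((hcount.image _).union (hcount.image _)).mono hsub)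
end

section
/- Let I be infinite and 1 < p < ∞. For a bounded linear operator T on ℓᵖ(I), T preserves majorization if and only if T = ∑_{i∈I₀} α_i P_{σ_i}, where I₀ is a countable subset of I, (α_i)_{i∈I₀} ∈ ℓᵖ(I₀), and {σ_i : I → I ; i ∈ I₀} is a family of injections with pairwise disjoint ranges (the series converging in operator norm). -/
open scoped ENNReal

namespace S19

open Filter Topology

/-- Supporting line property. -/
def SL (φ : ℝ → ℝ) : Prop := ∀ x, ∃ c, ∀ y, φ x + c * (y - x) ≤ φ y

lemma SL_of_convex {φ : ℝ → ℝ} (h : ConvexOn ℝ Set.univ φ) : SL φ := by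
  intro x
  refine ⟨derivWithin φ (Set.Ioi x) x, fun y => ?_⟩
  have hx : x ∈ interior (Set.univ : Set ℝ) := by simp
  rcases lt_trichotomy y x with hy | rfl | hy
  · have h1 := h.slope_le_leftDeriv_of_mem_interior (Set.mem_univ y) hx hy
    have h2 := h.leftDeriv_le_rightDeriv_of_mem_interior hx
    have h3 := h1.trans h2
    rw [slope_def_field, div_le_iff₀ (by linarith)] at h3
    linarith
  · simp
  · have h1 := h.rightDeriv_le_slope_of_mem_interior hx (Set.mem_univ y) hy
    rw [slope_def_field, le_div_iff₀ (by linarith)] at h1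
    linarith

variable {I : Type*}

/-- Doubly stochastic matrix. -/
structure DS (d : I → I → ℝ) : Prop where
  nonneg : ∀ i j, 0 ≤ d i j
  row : ∀ i, HasSum (fun j => d i j) 1
  col : ∀ j, HasSum (fun i => d i j) 1

lemma DS.le_one {d : I → I → ℝ} (h : DS d) (i j : I) : d i j ≤ 1 :=
  le_hasSum (h.row i) j (fun k _ => h.nonneg i k)

lemma jensen {d : I → I → ℝ} (hd : DS d) {φ : ℝ → ℝ} (hφ : SL φ) (g : I → ℝ) (i : I) (a : ℝ)
    (ha : HasSum (fun j => d i j * g j) a) (hs : Summable (fun j => d i j * φ (g j))) :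
    φ a ≤ ∑' j, d i j * φ (g j) := by
  obtain ⟨c, hc⟩ := hφ a
  have h1 : HasSum (fun j => (φ a - c * a) * d i j + c * (d i j * g j))
      ((φ a - c * a) * 1 + c * a) :=
    ((hd.row i).mul_left _).add (ha.mul_left c)
  have h2 := hasSum_le (fun j => ?_) h1 hs.hasSum
  · linarith
  · have := mul_le_mul_of_nonneg_left (hc (g j)) (hd.nonneg i j)
    nlinarith

lemma schur {d : I → I → ℝ} (hd : DS d) {φ : ℝ → ℝ} (hφ : SL φ) (h0 : ∀ x, 0 ≤ φ x)
    (f g : I → ℝ) (hf : ∀ i, HasSum (fun j => d i j * g j) (f i))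
    (hs : Summable (fun j => φ (g j))) :
    Summable (fun j => φ (f j)) ∧ ∑' j, φ (f j) ≤ ∑' j, φ (g j) := by
  have hrow : ∀ i, Summable (fun j => d i j * φ (g j)) := fun i =>
    Summable.of_nonneg_of_le (fun j => mul_nonneg (hd.nonneg i j) (h0 _))
      (fun j => mul_le_of_le_one_left (h0 _) (hd.le_one i j)) hs
  have hcol : ∀ j, HasSum (fun i => d i j * φ (g j)) (φ (g j)) := fun j => by
    simpa using (hd.col j).mul_right (φ (g j))
  have hprod : Summable (fun q : I × I => d q.2 q.1 * φ (g q.1)) := by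
    rw [summable_prod_of_nonneg]
    · refine ⟨fun j => (hcol j).summable, ?_⟩
      simpa [fun j => (hcol j).tsum_eq] using hs
    · exact fun q => mul_nonneg (hd.nonneg _ _) (h0 _)
  have hprod' : Summable (fun q : I × I => d q.1 q.2 * φ (g q.2)) := hprod.prod_symm
  have hsum : Summable (fun i => ∑' j, d i j * φ (g j)) := hprod'.prod
  have hle : ∀ i, φ (f i) ≤ ∑' j, d i j * φ (g j) := fun i =>
    jensen hd hφ g i _ (hf i) (hrow i)
  have hS : Summable (fun j => φ (f j)) := Summable.of_nonneg_of_le (fun _ => h0 _) hle hsum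
  refine ⟨hS, (hS.tsum_le_tsum hle hsum).trans (le_of_eq ?_)⟩
  rw [Summable.tsum_comm (f := fun j i => d i j * φ (g j)) hprod]
  exact tsum_congr fun j => (hcol j).tsum_eq

lemma SL_abs_rpow {p : ℝ} (hp : 1 ≤ p) : SL (fun x => ‖x‖ ^ p) := by
  apply SL_of_convex
  have h1 : ConvexOn ℝ Set.univ (fun x : ℝ => ‖x‖) := convexOn_univ_norm
  refine ⟨convex_univ, fun x _ y _ a b ha hb hab => ?_⟩
  have h2 := h1.2 (Set.mem_univ x) (Set.mem_univ y) ha hb hab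
  have h3 := (convexOn_rpow hp).2 (norm_nonneg x) (norm_nonneg y) ha hb hab
  exact (Real.rpow_le_rpow (norm_nonneg _) h2 (by linarith)).trans h3

variable {p : ℝ≥0∞} [Fact (1 ≤ p)]

lemma one_le_toReal (hp2 : p ≠ ∞) : 1 ≤ p.toReal := by
  have : (1 : ℝ≥0∞) ≤ p := Fact.out
  simpa using ENNReal.toReal_mono hp2 this

lemma stdb_apply [DecidableEq I] (i j : I) : stdb p i j = if j = i then 1 else 0 := by
  have : stdb p i = lp.single p i (1 : ℝ) := by unfold stdb; congr; exact Subsingleton.elim _ _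
  rw [this, lp.single_apply, Pi.single_apply]

lemma hasSum_stdb (hp2 : p ≠ ∞) (f : lp (fun _ : I => ℝ) p) :
    HasSum (fun i => f i • stdb p i) f := by
  classical
  convert lp.hasSum_single hp2 f using 2 with i
  unfold stdb
  rw [← lp.single_smul]
  simp

/-- Coordinate evaluation. -/
noncomputable def ev (p : ℝ≥0∞) [Fact (1 ≤ p)] (i : I) : lp (fun _ : I => ℝ) p →L[ℝ] ℝ :=
  lp.evalCLM ℝ (fun _ : I => ℝ) p i

lemma ev_apply (i : I) (f : lp (fun _ : I => ℝ) p) : ev p i f = f i := rfl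

lemma hasSum_apply (hp2 : p ≠ ∞) (A : lp (fun _ : I => ℝ) p →L[ℝ] lp (fun _ : I => ℝ) p)
    (g : lp (fun _ : I => ℝ) p) (i : I) :
    HasSum (fun j => A (stdb p j) i * g j) (A g i) := by
  have h := (hasSum_stdb hp2 g).mapL ((ev p i).comp A)
  have h2 : ∀ j, ((ev p i).comp A) (g j • stdb p j) = A (stdb p j) i * g j := fun j => by
    rw [map_smul, smul_eq_mul, mul_comm]; rfl
  simp only [h2] at h
  exact h

lemma ext_stdb (hp2 : p ≠ ∞) {A B : lp (fun _ : I => ℝ) p →L[ℝ] lp (fun _ : I => ℝ) p}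
    (h : ∀ j, A (stdb p j) = B (stdb p j)) : A = B := by
  ext g i
  have h1 := hasSum_apply hp2 A g i
  simp only [h] at h1
  exact h1.unique (hasSum_apply hp2 B g i)

lemma pne0 : p ≠ 0 := (zero_lt_one.trans_le (Fact.out : 1 ≤ p)).ne'

lemma DS.summable_mul {d : I → I → ℝ} (hd : DS d) (g : lp (fun _ : I => ℝ) p) (i : I) :
    Summable (fun j => d i j * g j) := by
  refine Summable.of_norm_bounded ((hd.row i).summable.mul_right ‖g‖) fun j => ?_
  rw [norm_mul, Real.norm_of_nonneg (hd.nonneg i j)]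
  exact mul_le_mul_of_nonneg_left (lp.norm_apply_le_norm pne0 g j) (hd.nonneg i j)

lemma maj_iff (hp2 : p ≠ ∞) (f g : lp (fun _ : I => ℝ) p) :
    Majorized f g ↔ ∃ d : I → I → ℝ, DS d ∧ ∀ i, HasSum (fun j => d i j * g j) (f i) := by
  classical
  have hp := one_le_toReal hp2
  constructor
  · rintro ⟨D, ⟨⟨h0, hr⟩, ⟨_, hc⟩⟩, rfl⟩
    refine ⟨fun i j => D (stdb p j) i, ⟨fun i j => h0 _ (fun k => ?_) i, hr, hc⟩,
      fun i => hasSum_apply hp2 D g i⟩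
    rw [stdb_apply]; split_ifs <;> norm_num
  · rintro ⟨d, hd, hf⟩
    have key : ∀ g : lp (fun _ : I => ℝ) p, Summable (fun i => ‖∑' j, d i j * g j‖ ^ p.toReal) ∧
        ∑' i, ‖∑' j, d i j * g j‖ ^ p.toReal ≤ ∑' i, ‖g i‖ ^ p.toReal := fun g =>
      schur hd (SL_abs_rpow hp) (fun x => by positivity) (fun i => ∑' j, d i j * g j) g
        (fun i => (hd.summable_mul g i).hasSum) ((lp.memℓp g).summable (by linarith))
    let L : lp (fun _ : I => ℝ) p →ₗ[ℝ] lp (fun _ : I => ℝ) p :=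
      { toFun := fun g => ⟨fun i => ∑' j, d i j * g j, memℓp_gen (key g).1⟩
        map_add' := fun g h => by
          ext i
          simp only [lp.coeFn_add, Pi.add_apply, mul_add]
          exact (hd.summable_mul g i).tsum_add (hd.summable_mul h i)
        map_smul' := fun c g => by
          ext i
          simp only [lp.coeFn_smul, Pi.smul_apply, smul_eq_mul, RingHom.id_apply]
          rw [← tsum_mul_left]
          exact tsum_congr fun j => by ring }
    have hL : ∀ g i, L g i = ∑' j, d i j * g j := fun _ _ => rfl
    let D := L.mkContinuous 1 (fun g => by
      refine lp.norm_le_of_tsum_le (by linarith) (by positivity) ?_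
      rw [one_mul, lp.norm_rpow_eq_tsum (by linarith) g]
      exact (key g).2)
    have hD : ∀ g i, D g i = ∑' j, d i j * g j := fun _ _ => rfl
    have hDe : ∀ i j, D (stdb p j) i = d i j := fun i j => by
      rw [hD, tsum_eq_single j]
      · simp [stdb_apply]
      · intro k hk; simp [stdb_apply, hk]
    have hpos : IsPositiveOp D := fun g hg i => by
      rw [hD]; exact tsum_nonneg fun j => mul_nonneg (hd.nonneg i j) (hg j)
    refine ⟨D, ⟨⟨hpos, fun i => ?_⟩, ⟨hpos, fun j => ?_⟩⟩, ?_⟩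
    · simpa only [hDe] using hd.row i
    · simpa only [hDe] using hd.col j
    · ext i; rw [hD]; exact (hf i).tsum_eq.symm


lemma P_apply (hp2 : p ≠ ∞) {σ : I → I} (hσ : Function.Injective σ)
    {P : lp (fun _ : I => ℝ) p →L[ℝ] lp (fun _ : I => ℝ) p}
    (hP : ∀ j, P (stdb p j) = stdb p (σ j)) (g : lp (fun _ : I => ℝ) p) (s : I) :
    P g (σ s) = g s := by
  classical
  have h := hasSum_apply hp2 P g (σ s)
  simp only [hP, stdb_apply] at h
  refine h.unique ?_
  convert hasSum_single s ?_ using 1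
  · simp
  · intro b hb
    simp [hσ.ne hb.symm]

lemma P_apply_not (hp2 : p ≠ ∞) {σ : I → I}
    {P : lp (fun _ : I => ℝ) p →L[ℝ] lp (fun _ : I => ℝ) p}
    (hP : ∀ j, P (stdb p j) = stdb p (σ j)) (g : lp (fun _ : I => ℝ) p) (r : I)
    (hr : ∀ s, r ≠ σ s) : P g r = 0 := by
  classical
  have h := hasSum_apply hp2 P g r
  simp only [hP, stdb_apply] at h
  refine h.unique ?_
  simp [hr]

lemma sum_apply {ι : Type*} {A : ι → lp (fun _ : I => ℝ) p →L[ℝ] lp (fun _ : I => ℝ) p}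
    {T : lp (fun _ : I => ℝ) p →L[ℝ] lp (fun _ : I => ℝ) p} (h : HasSum A T)
    (g : lp (fun _ : I => ℝ) p) (r : I) : HasSum (fun i => A i g r) (T g r) :=
  h.mapL ((ev p r).comp (ContinuousLinearMap.apply ℝ (lp (fun _ : I => ℝ) p) g))

lemma exists_block {ι : Type*} {σ : ι → I → I} (hσ : ∀ i, Function.Injective (σ i))
    (hdis : ∀ i j s t, σ i s = σ j t → i = j) {d : I → I → ℝ} (hd : DS d) :
    ∃ d' : I → I → ℝ, DS d' ∧ (∀ i s t, d' (σ i s) (σ i t) = d s t) ∧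
      (∀ i s j, (∀ t, j ≠ σ i t) → d' (σ i s) j = 0) ∧
      (∀ r j, (∀ i s, r ≠ σ i s) → r ≠ j → d' r j = 0) := by
  classical
  let d' : I → I → ℝ := fun r j => if h : ∃ q : ι × I, r = σ q.1 q.2 then
      (if h' : ∃ t, j = σ h.choose.1 t then d h.choose.2 h'.choose else 0)
    else if r = j then 1 else 0
  have h1 : ∀ i s t, d' (σ i s) (σ i t) = d s t := by
    intro i s t
    have h : ∃ q : ι × I, σ i s = σ q.1 q.2 := ⟨(i, s), rfl⟩
    have hi : h.choose.1 = i := (hdis _ _ _ _ h.choose_spec).symm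
    have hs : h.choose.2 = s := by
      have := h.choose_spec
      rw [hi] at this
      exact (hσ i this).symm
    have h' : ∃ t', σ i t = σ h.choose.1 t' := ⟨t, by rw [hi]⟩
    have ht : h'.choose = t := by
      have := h'.choose_spec
      have h2 : σ i t = σ i h'.choose := this.trans (congrFun (congrArg σ hi) _)
      exact (hσ i h2).symm
    simp only [d']
    rw [dif_pos h, dif_pos h', hs, ht]
  have h2 : ∀ i s j, (∀ t, j ≠ σ i t) → d' (σ i s) j = 0 := by
    intro i s j hj
    have h : ∃ q : ι × I, σ i s = σ q.1 q.2 := ⟨(i, s), rfl⟩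
    have hi : h.choose.1 = i := (hdis _ _ _ _ h.choose_spec).symm
    have h' : ¬ ∃ t', j = σ h.choose.1 t' := by
      rw [hi]; rintro ⟨t, ht⟩; exact hj t ht
    simp only [d']
    rw [dif_pos h, dif_neg h']
  have h3 : ∀ r j, (∀ i s, r ≠ σ i s) → d' r j = if r = j then 1 else 0 := by
    intro r j hr
    have h : ¬ ∃ q : ι × I, r = σ q.1 q.2 := by rintro ⟨q, hq⟩; exact hr _ _ hq
    simp only [d']
    rw [dif_neg h]
  have h4 : ∀ i t r, (∀ s, r ≠ σ i s) → d' r (σ i t) = 0 := by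
    intro i t r hr
    by_cases h : ∃ q : ι × I, r = σ q.1 q.2
    · obtain ⟨⟨k, s⟩, rfl⟩ := h
      refine h2 k s _ fun t' ht' => ?_
      obtain rfl := hdis _ _ _ _ ht'
      exact hr s rfl
    · rw [h3 _ _ (fun i s hh => h ⟨(i, s), hh⟩), if_neg (hr t)]
  refine ⟨d', ⟨?_, ?_, ?_⟩, h1, h2, fun r j hr hrj => by rw [h3 r j hr, if_neg hrj]⟩
  · intro r j
    simp only [d']
    split_ifs <;> first | exact hd.nonneg _ _ | norm_num
  · intro r
    by_cases h : ∃ q : ι × I, r = σ q.1 q.2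
    · obtain ⟨⟨i, s⟩, rfl⟩ := h
      rw [← (hσ i).hasSum_iff (f := fun j => d' (σ i s) j)]
      · simpa [Function.comp_def, h1] using hd.row s
      · intro j hj
        exact h2 i s j fun t ht => hj ⟨t, ht.symm⟩
    · have h' : ∀ i s, r ≠ σ i s := fun i s hh => h ⟨(i, s), hh⟩
      simp only [h3 r _ h']
      exact hasSum_ite_eq' r 1
  · intro j
    by_cases h : ∃ q : ι × I, j = σ q.1 q.2
    · obtain ⟨⟨i, s⟩, rfl⟩ := h
      rw [← (hσ i).hasSum_iff (f := fun r => d' r (σ i s))]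
      · simpa [Function.comp_def, h1] using hd.col s
      · intro r hr
        exact h4 i s r fun t ht => hr ⟨t, ht.symm⟩
    · have h' : ∀ i s, j ≠ σ i s := fun i s hh => h ⟨(i, s), hh⟩
      have : ∀ r, d' r j = if r = j then 1 else 0 := by
        intro r
        by_cases hr : ∃ q : ι × I, r = σ q.1 q.2
        · obtain ⟨⟨i, s⟩, rfl⟩ := hr
          rw [h2 i s j (h' i), if_neg (h' i s).symm]
        · exact h3 r j fun i s hh => hr ⟨(i, s), hh⟩
      simp only [this]
      exact hasSum_ite_eq j 1

lemma backward (hp2 : p ≠ ∞) {ι : Type*} (α : ι → ℝ) (σ : ι → I → I)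
    (P : ι → lp (fun _ : I => ℝ) p →L[ℝ] lp (fun _ : I => ℝ) p)
    (T : lp (fun _ : I => ℝ) p →L[ℝ] lp (fun _ : I => ℝ) p)
    (hσ : ∀ i, Function.Injective (σ i))
    (hdis : ∀ i j s t, σ i s = σ j t → i = j)
    (hP : ∀ i j, P i (stdb p j) = stdb p (σ i j))
    (hT : HasSum (fun i => α i • P i) T) : PreservesMajorization T := by
  classical
  have T1 : ∀ g i s, T g (σ i s) = α i * g s := by
    intro g i s
    have h := sum_apply hT g (σ i s)
    refine h.unique ?_
    convert hasSum_single i ?_ using 1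
    · simp [P_apply hp2 (hσ i) (hP i)]
    · intro k hk
      simp [P_apply_not hp2 (hP k) g (σ i s) fun t ht => hk (hdis _ _ _ _ ht).symm]
  have T2 : ∀ g r, (∀ i s, r ≠ σ i s) → T g r = 0 := by
    intro g r hr
    have h := sum_apply hT g r
    refine h.unique ?_
    simp [fun k => P_apply_not hp2 (hP k) g r (hr k)]
  intro f g hfg
  rw [maj_iff hp2] at hfg ⊢
  obtain ⟨d, hd, hf⟩ := hfg
  obtain ⟨d', hd', h1, h2, h3⟩ := exists_block hσ hdis hd
  refine ⟨d', hd', fun r => ?_⟩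
  by_cases h : ∃ q : ι × I, r = σ q.1 q.2
  · obtain ⟨⟨i, s⟩, rfl⟩ := h
    rw [← (hσ i).hasSum_iff (f := fun j => d' (σ i s) j * T g j)]
    · simp only [Function.comp_def, h1, T1]
      have e : (fun x => d s x * (α i * g x)) = fun x => α i * (d s x * g x) := by
        funext x; ring
      rw [e]
      exact (hf s).mul_left (α i)
    · intro j hj
      simp only
      rw [h2 i s j fun t ht => hj ⟨t, ht.symm⟩, zero_mul]
  · have h' : ∀ i s, r ≠ σ i s := fun i s hh => h ⟨(i, s), hh⟩
    rw [T2 f r h']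
    convert hasSum_zero using 2 with j
    by_cases hj : r = j
    · subst hj; rw [T2 g r h', mul_zero]
    · rw [h3 r j h' hj, zero_mul]


lemma perm_maj (hp2 : p ≠ ∞) (π : Equiv.Perm I) (f g : lp (fun _ : I => ℝ) p)
    (h : ∀ i, f i = g (π i)) : Majorized f g := by
  classical
  rw [maj_iff hp2]
  refine ⟨fun i j => if j = π i then 1 else 0, ⟨?_, ?_, ?_⟩, ?_⟩
  · intro i j
    split_ifs <;> norm_num
  · intro i
    exact hasSum_ite_eq (π i) 1
  · intro j
    have : ∀ i, (j = π i) ↔ (i = π.symm j) := fun i => by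
      rw [Equiv.eq_symm_apply]; exact eq_comm
    simp only [this]
    exact hasSum_ite_eq (π.symm j) 1
  · intro i
    simp only [ite_mul, one_mul, zero_mul, h i]
    convert hasSum_single (π i) ?_ using 1
    · simp
    · intro b hb; simp [hb]

lemma mutual_eq (hp2 : p ≠ ∞) {f g : lp (fun _ : I => ℝ) p} (h1 : Majorized f g)
    (h2 : Majorized g f) {φ : ℝ → ℝ} (hφ : SL φ) (h0 : ∀ x, 0 ≤ φ x)
    (hs : Summable (fun i => φ (g i))) : ∑' i, φ (f i) = ∑' i, φ (g i) := by
  rw [maj_iff hp2] at h1 h2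
  obtain ⟨d, hd, hf⟩ := h1
  obtain ⟨d', hd', hf'⟩ := h2
  have a := schur hd hφ h0 f g hf hs
  exact le_antisymm a.2 (schur hd' hφ h0 g f hf' a.1).2

lemma summable_pow (hp2 : p ≠ ∞) {m : ℕ} (hm : p.toReal ≤ ((2 * m : ℕ) : ℝ))
    (f : lp (fun _ : I => ℝ) p) :
    Summable (fun i => (f i) ^ (2 * m)) := by
  have h1 : Memℓp (fun i => f i) ((2 * m : ℕ) : ℝ≥0∞) := by
    refine (lp.memℓp f).of_exponent_ge ?_
    rw [← ENNReal.ofReal_toReal hp2, ← ENNReal.ofReal_natCast]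
    exact ENNReal.ofReal_le_ofReal hm
  have hp := one_le_toReal hp2
  have h2 := h1.summable (by rw [ENNReal.toReal_natCast]; linarith)
  simp only [ENNReal.toReal_natCast, Real.rpow_natCast] at h2
  refine h2.congr fun i => ?_
  rw [Real.norm_eq_abs, (even_two_mul m).pow_abs]

/-- The defect function. -/
def hh (m : ℕ) (x y : ℝ) : ℝ :=
  (x + y) ^ (2 * m) + (x - y) ^ (2 * m) - 2 * x ^ (2 * m) - 2 * y ^ (2 * m)

lemma pow_super {m : ℕ} (hm : 2 ≤ m) {a b : ℝ} (ha : 0 < a) (hb : 0 < b) :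
    a ^ m + b ^ m < (a + b) ^ m := by
  induction m, hm using Nat.le_induction with
  | base => nlinarith [mul_pos ha hb]
  | succ k hk ih =>
    rw [pow_succ, pow_succ, pow_succ]
    have h1 : 0 < a ^ k := by positivity
    have h2 : 0 < b ^ k := by positivity
    nlinarith [mul_pos h1 hb, mul_pos h2 ha, mul_lt_mul_of_pos_right ih (add_pos ha hb)]

lemma hh_ge (m : ℕ) (x y : ℝ) :
    2 * ((x ^ 2 + y ^ 2) ^ m - (x ^ 2) ^ m - (y ^ 2) ^ m) ≤ hh m x y := by
  unfold hh
  simp only [pow_mul]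
  have h := (convexOn_pow (𝕜 := ℝ) m).2 (Set.mem_Ici.2 (sq_nonneg (x + y)))
    (Set.mem_Ici.2 (sq_nonneg (x - y)))
    (by norm_num : (0 : ℝ) ≤ 1 / 2) (by norm_num : (0 : ℝ) ≤ 1 / 2) (by norm_num)
  simp only [smul_eq_mul] at h
  have e : (1 / 2 * (x + y) ^ 2 + 1 / 2 * (x - y) ^ 2) = x ^ 2 + y ^ 2 := by ring
  rw [e] at h
  linarith

lemma hh_pos {m : ℕ} (hm : 2 ≤ m) {x y : ℝ} (hx : x ≠ 0) (hy : y ≠ 0) : 0 < hh m x y := by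
  have h1 := hh_ge m x y
  have h2 := pow_super hm (a := x ^ 2) (b := y ^ 2) (by positivity) (by positivity)
  linarith

lemma hh_zero_right {m : ℕ} (hm : 2 ≤ m) (x : ℝ) : hh m x 0 = 0 := by
  have : 2 * m ≠ 0 := by omega
  simp [hh, this]; ring

lemma hh_zero_left {m : ℕ} (hm : 2 ≤ m) (x : ℝ) : hh m 0 x = 0 := by
  have : 2 * m ≠ 0 := by omega
  simp [hh, this, (even_two_mul m).neg_pow]; ring

lemma hh_nonneg {m : ℕ} (hm : 2 ≤ m) (x y : ℝ) : 0 ≤ hh m x y := by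
  by_cases hx : x = 0
  · rw [hx, hh_zero_left hm]
  by_cases hy : y = 0
  · rw [hy, hh_zero_right hm]
  exact (hh_pos hm hx hy).le

lemma hh_bound (m : ℕ) {ε : ℝ} (hε : 0 < ε) :
    ∃ C, 0 ≤ C ∧ ∀ x y, hh m x y ≤ C * x ^ (2 * m) + ε * y ^ (2 * m) := by
  have ht : Tendsto (fun l : ℝ => 2 * ((1 - l) * ((1 - l)⁻¹) ^ (2 * m)) - 2) (𝓝[>] 0) (𝓝 0) := by
    have : ContinuousAt (fun l : ℝ => 2 * ((1 - l) * ((1 - l)⁻¹) ^ (2 * m)) - 2) 0 := by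
      have h : ContinuousAt (fun l : ℝ => (1 - l)⁻¹) 0 :=
        ContinuousAt.inv₀ (by fun_prop) (by norm_num)
      fun_prop
    have h2 := this.tendsto
    simp only [sub_zero, inv_one, one_pow, mul_one, sub_self] at h2
    exact h2.mono_left nhdsWithin_le_nhds
  have h1 : ∀ᶠ l : ℝ in 𝓝[>] 0, 2 * ((1 - l) * ((1 - l)⁻¹) ^ (2 * m)) - 2 < ε :=
    ht.eventually (gt_mem_nhds hε)
  have h2 : ∀ᶠ l : ℝ in 𝓝[>] 0, l ∈ Set.Ioo (0 : ℝ) 1 := Ioo_mem_nhdsGT one_pos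
  obtain ⟨l, hl1, hl0, hl2⟩ := (h1.and h2).exists
  have hne : (1 - l) ≠ 0 := by linarith
  have conv : ∀ x y : ℝ, (x + y) ^ (2 * m) ≤
      l * (l⁻¹) ^ (2 * m) * x ^ (2 * m) + (1 - l) * ((1 - l)⁻¹) ^ (2 * m) * y ^ (2 * m) := by
    intro x y
    have h := ((even_two_mul m).convexOn_pow (𝕜 := ℝ)).2 (Set.mem_univ (l⁻¹ * x))
      (Set.mem_univ ((1 - l)⁻¹ * y)) hl0.le (by linarith : 0 ≤ 1 - l) (by ring)
    simp only [smul_eq_mul, mul_inv_cancel_left₀ hl0.ne', mul_inv_cancel_left₀ hne, mul_pow] at h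
    linarith
  refine ⟨2 * (l * (l⁻¹) ^ (2 * m)), by positivity, fun x y => ?_⟩
  have c1 := conv x y
  have c2 := conv x (-y)
  rw [(even_two_mul m).neg_pow, ← sub_eq_add_neg] at c2
  have hx : 0 ≤ x ^ (2 * m) := (even_two_mul m).pow_nonneg x
  have hy : 0 ≤ y ^ (2 * m) := (even_two_mul m).pow_nonneg y
  have := mul_le_mul_of_nonneg_right hl1.le hy
  unfold hh
  linarith

lemma tendsto_row (hp1 : 1 < p) (hp2 : p ≠ ∞)
    (T : lp (fun _ : I => ℝ) p →L[ℝ] lp (fun _ : I => ℝ) p) (r : I) :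
    Tendsto (fun k => T (stdb p k) r) cofinite (𝓝 0) := by
  classical
  have hp : 1 < p.toReal := by
    simpa using (ENNReal.toReal_lt_toReal ENNReal.one_ne_top hp2).2 hp1
  rw [Metric.tendsto_nhds]
  intro ε hε
  simp only [dist_zero_right]
  rw [eventually_cofinite]
  simp only [not_lt]
  by_contra hinf
  have hinf : Set.Infinite {k | ε ≤ ‖T (stdb p k) r‖} := hinf
  have key : ∀ N : ℕ, (N * ε) ^ p.toReal ≤ ‖T‖ ^ p.toReal * N := by
    intro N
    obtain ⟨F, hF, hN⟩ := hinf.exists_subset_card_eq N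
    set a : I → ℝ := fun k => T (stdb p k) r with ha
    let v : lp (fun _ : I => ℝ) p := ∑ k ∈ F, (SignType.sign (a k) : ℝ) • stdb p k
    have hv : ‖v‖ ^ p.toReal = N := by
      have h := lp.norm_sum_single (E := fun _ : I => ℝ) (p := p) (by linarith)
        (fun k => (SignType.sign (a k) : ℝ)) F
      have e : v = ∑ k ∈ F, lp.single p k (SignType.sign (a k) : ℝ) := by
        refine Finset.sum_congr rfl fun k _ => ?_
        ext j
        rw [lp.coeFn_smul, Pi.smul_apply, stdb_apply, lp.single_apply, Pi.single_apply]
        simp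
      rw [e, h, ← hN, Finset.sum_congr rfl (g := fun _ => (1 : ℝ))]
      · simp
      · intro k hk
        have h0 : a k ≠ 0 := fun h0 => by
          have : ε ≤ ‖a k‖ := hF hk
          rw [h0, norm_zero] at this
          linarith
        rcases lt_or_gt_of_ne h0 with h | h
        · simp [sign_neg h]
        · simp [sign_pos h]
    have hTv : T v r = ∑ k ∈ F, |a k| := by
      rw [← ev_apply (p := p) r (T v)]
      simp only [v, map_sum, map_smul, smul_eq_mul]
      refine Finset.sum_congr rfl fun k _ => ?_
      rw [ev_apply]
      exact sign_mul_self (a k)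
    have h1 : N * ε ≤ ‖T‖ * ‖v‖ := by
      calc N * ε = ∑ k ∈ F, ε := by simp [hN]
        _ ≤ ∑ k ∈ F, |a k| := Finset.sum_le_sum fun k hk => hF hk
        _ = T v r := hTv.symm
        _ ≤ ‖T v r‖ := le_abs_self _
        _ ≤ ‖T v‖ := lp.norm_apply_le_norm pne0 _ _
        _ ≤ _ := T.le_opNorm v
    have h2 := Real.rpow_le_rpow (by positivity) h1 (by linarith : 0 ≤ p.toReal)
    rwa [Real.mul_rpow (norm_nonneg _) (norm_nonneg _), hv] at h2
  have ht : Tendsto (fun N : ℕ => (N : ℝ) ^ (p.toReal - 1)) atTop atTop :=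
    (tendsto_rpow_atTop (by linarith)).comp tendsto_natCast_atTop_atTop
  obtain ⟨N, hN1, hN0⟩ := ((ht.eventually_gt_atTop (‖T‖ ^ p.toReal / ε ^ p.toReal)).and
    (eventually_gt_atTop 0)).exists
  have hN0 : (0 : ℝ) < N := by exact_mod_cast hN0
  have hk := key N
  rw [Real.mul_rpow hN0.le hε.le] at hk
  rw [div_lt_iff₀ (by positivity), Real.rpow_sub_one hN0.ne'] at hN1
  have := mul_lt_mul_of_pos_right hN1 hN0
  rw [show (N : ℝ) ^ p.toReal / N * ε ^ p.toReal * N = (N : ℝ) ^ p.toReal * ε ^ p.toReal by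
    field_simp] at this
  linarith

lemma disjoint_cols [Infinite I] (hp1 : 1 < p) (hp2 : p ≠ ∞)
    (T : lp (fun _ : I => ℝ) p →L[ℝ] lp (fun _ : I => ℝ) p) (hT : PreservesMajorization T)
    {i k₀ : I} (hik : k₀ ≠ i) (r₀ : I) (hx : T (stdb p i) r₀ ≠ 0) (hy : T (stdb p k₀) r₀ ≠ 0) :
    False := by
  classical
  obtain ⟨m, hm⟩ := exists_nat_ge (max p.toReal 2)
  have hm2 : 2 ≤ m := by exact_mod_cast (le_max_right _ _).trans hm
  have hmp : p.toReal ≤ ((2 * m : ℕ) : ℝ) := by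
    have := (le_max_left _ _).trans hm
    push_cast
    have : (0 : ℝ) ≤ m := by positivity
    linarith
  have hsum := fun f : lp (fun _ : I => ℝ) p => summable_pow hp2 hmp f
  set x := T (stdb p i) with hxdef
  -- power sums agree
  have hΦ : ∀ f g : lp (fun _ : I => ℝ) p, (∃ π : Equiv.Perm I, ∀ j, f j = g (π j)) →
      ∑' r, (T f r) ^ (2 * m) = ∑' r, (T g r) ^ (2 * m) := by
    rintro f g ⟨π, hπ⟩
    refine mutual_eq hp2 (hT _ _ (perm_maj hp2 π f g hπ))
      (hT _ _ (perm_maj hp2 π.symm g f fun j => ?_))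
      (φ := fun x => x ^ (2 * m)) (SL_of_convex (even_two_mul m).convexOn_pow)
      (fun x => (even_two_mul m).pow_nonneg x) (hsum _)
    rw [hπ]; simp
  have hS : ∀ k, ∑' r, (T (stdb p k) r) ^ (2 * m) = ∑' r, (T (stdb p k₀) r) ^ (2 * m) := by
    intro k
    refine hΦ _ _ ⟨Equiv.swap k k₀, fun j => ?_⟩
    rw [stdb_apply, stdb_apply]
    congr 1
    rw [Equiv.swap_apply_eq_iff]; simp
  have hS2 : ∀ k, k ≠ i → ∀ c : ℝ, ∑' r, (T (stdb p i + c • stdb p k) r) ^ (2 * m) =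
      ∑' r, (T (stdb p i + c • stdb p k₀) r) ^ (2 * m) := by
    intro k hk c
    refine hΦ _ _ ⟨Equiv.swap k k₀, fun j => ?_⟩
    simp only [lp.coeFn_add, lp.coeFn_smul, Pi.add_apply, Pi.smul_apply, stdb_apply]
    rw [Equiv.swap_apply_eq_iff, Equiv.swap_apply_eq_iff, Equiv.swap_apply_right,
      Equiv.swap_apply_of_ne_of_ne hk.symm hik.symm]
  -- the sum of defects
  have hhsum : ∀ k, HasSum (fun r => hh m (x r) (T (stdb p k) r))
      (∑' r, (T (stdb p i + (1 : ℝ) • stdb p k) r) ^ (2 * m) +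
       ∑' r, (T (stdb p i + (-1 : ℝ) • stdb p k) r) ^ (2 * m) -
       2 * ∑' r, (x r) ^ (2 * m) - 2 * ∑' r, (T (stdb p k) r) ^ (2 * m)) := by
    intro k
    have h := (((hsum (T (stdb p i + (1 : ℝ) • stdb p k))).hasSum.add
      (hsum (T (stdb p i + (-1 : ℝ) • stdb p k))).hasSum).sub ((hsum x).hasSum.mul_left 2)).sub
      ((hsum (T (stdb p k))).hasSum.mul_left 2)
    refine h.congr_fun ?_
    intro r
    simp [hh, ← hxdef, sub_eq_add_neg]
  have hG : ∀ k, k ≠ i → ∑' r, hh m (x r) (T (stdb p k) r) =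
      ∑' r, hh m (x r) (T (stdb p k₀) r) := by
    intro k hk
    rw [(hhsum k).tsum_eq, (hhsum k₀).tsum_eq, hS2 k hk, hS2 k hk, hS k]
  set G := ∑' r, hh m (x r) (T (stdb p k₀) r) with hGdef
  set S := ∑' r, (T (stdb p k₀) r) ^ (2 * m) with hSdef
  have hS0 : 0 ≤ S := tsum_nonneg fun r => (even_two_mul m).pow_nonneg _
  have hGpos : 0 < G :=
    (hhsum k₀).summable.tsum_pos (fun r => hh_nonneg hm2 _ _) r₀ (hh_pos hm2 hx hy)
  set ε := G / (2 * (S + 1)) with hε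
  have hεpos : 0 < ε := by positivity
  obtain ⟨C, hC, hb⟩ := hh_bound m hεpos
  let w : I → I → ℝ := fun k r =>
    max 0 (hh m (x r) (T (stdb p k) r) - ε * (T (stdb p k) r) ^ (2 * m))
  have hwb : ∀ k r, ‖w k r‖ ≤ C * (x r) ^ (2 * m) := by
    intro k r
    rw [Real.norm_of_nonneg (le_max_left _ _)]
    refine max_le (mul_nonneg hC ((even_two_mul m).pow_nonneg _)) ?_
    linarith [hb (x r) (T (stdb p k) r)]
  have hw : Tendsto (fun k => ∑' r, w k r) cofinite (𝓝 (∑' _ : I, (0 : ℝ))) := by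
    refine tendsto_tsum_of_dominated_convergence ((hsum x).mul_left C) (fun r => ?_)
      (Eventually.of_forall fun k r => hwb k r)
    have hc : Continuous fun y : ℝ => max 0 (hh m (x r) y - ε * y ^ (2 * m)) := by
      unfold hh; fun_prop
    have h := (hc.tendsto 0).comp (tendsto_row hp1 hp2 T r)
    have h0 : 2 * m ≠ 0 := by omega
    rw [hh_zero_right hm2, zero_pow h0] at h
    simp only [mul_zero, sub_zero, max_self] at h
    exact h
  rw [tsum_zero] at hw
  have hle : ∀ k, k ≠ i → G ≤ ∑' r, w k r + ε * S := by
    intro k hk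
    rw [← hG k hk, ← hS k, ← tsum_mul_left]
    have hws : Summable (w k) := Summable.of_norm_bounded ((hsum x).mul_left C) (hwb k)
    rw [← hws.tsum_add ((hsum _).mul_left ε)]
    refine (hhsum k).summable.tsum_le_tsum (fun r => ?_) (hws.add ((hsum _).mul_left ε))
    have := le_max_right 0 (hh m (x r) (T (stdb p k) r) - ε * (T (stdb p k) r) ^ (2 * m))
    simp only [w]
    linarith
  have hev : ∀ᶠ k in cofinite, G ≤ ∑' r, w k r + ε * S := by
    have : ∀ᶠ k in cofinite, k ≠ i := by simp
    filter_upwards [this] with k hk using hle k hk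
  have hlim := ge_of_tendsto (hw.add_const (ε * S)) hev
  have : ε * (2 * (S + 1)) = G := by rw [hε]; field_simp
  nlinarith


lemma finite_gt (hp2 : p ≠ ∞) (f : lp (fun _ : I => ℝ) p) {t : ℝ} (ht : 0 < t) :
    {i | t < f i}.Finite := by
  have hp := one_le_toReal hp2
  have h := ((lp.memℓp f).summable (by linarith : 0 < p.toReal)).tendsto_cofinite_zero
  have h2 := h.eventually (gt_mem_nhds (by positivity : 0 < t ^ p.toReal))
  rw [eventually_cofinite] at h2
  refine h2.subset fun i hi => ?_
  have hi : t < f i := hi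
  simp only [Set.mem_ofPred_eq, not_lt]
  exact Real.rpow_le_rpow ht.le (hi.le.trans (le_abs_self _)) (by linarith)

lemma SL_pp (t : ℝ) : SL (fun x => max (x - t) 0) := by
  intro x
  by_cases h : t < x
  · refine ⟨1, fun y => ?_⟩
    simp only
    rw [max_eq_left (by linarith)]
    linarith [le_max_left (y - t) 0]
  · refine ⟨0, fun y => ?_⟩
    simp only
    rw [max_eq_right (by linarith)]
    linarith [le_max_right (y - t) 0]

lemma summable_pp (hp2 : p ≠ ∞) (f : lp (fun _ : I => ℝ) p) {t : ℝ} (ht : 0 < t) :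
    Summable (fun i => max (f i - t) 0) := by
  refine summable_of_hasFiniteSupport ((finite_gt hp2 f ht).subset fun i hi => ?_)
  by_contra h
  have h : ¬ t < f i := h
  exact hi (max_eq_right (by linarith))

lemma exists_gap (hp2 : p ≠ ∞) (f : lp (fun _ : I => ℝ) p) {a : ℝ} (ha : 0 < a) :
    ∃ ε > 0, ∀ i, |f i - a| < ε → f i = a := by
  have hfin : ((fun i => f i) '' {i | a / 2 < f i} \ {a}).Finite :=
    ((finite_gt hp2 f (half_pos ha)).image _).sdiff
  have ho := hfin.isClosed.isOpen_compl
  obtain ⟨ε, hε, hb⟩ := Metric.isOpen_iff.1 ho a (by simp)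
  refine ⟨min ε (a / 2), lt_min hε (half_pos ha), fun i hi => ?_⟩
  by_contra hne
  have h1 : f i ∈ Metric.ball a ε := by
    rw [Metric.mem_ball, Real.dist_eq]; exact hi.trans_le (min_le_left _ _)
  refine hb h1 ⟨⟨i, ?_, rfl⟩, hne⟩
  have := (abs_lt.1 (hi.trans_le (min_le_right _ _))).1
  show a / 2 < f i
  linarith

lemma tent {a ε x : ℝ} (hε : 0 < ε) (hx : |x - a| < ε → x = a) :
    max (x - (a - ε)) 0 - 2 * max (x - a) 0 + max (x - (a + ε)) 0 =
      if x = a then ε else 0 := by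
  by_cases h : x = a
  · subst h
    rw [if_pos rfl, max_eq_left (by linarith), max_eq_left (by linarith), max_eq_right (by linarith)]
    ring
  · rw [if_neg h]
    have h2 : ε ≤ |x - a| := not_lt.1 fun hlt => h (hx hlt)
    rcases le_abs.1 h2 with h3 | h3
    · rw [max_eq_left (by linarith), max_eq_left (by linarith), max_eq_left (by linarith)]
      ring
    · rw [max_eq_right (by linarith), max_eq_right (by linarith), max_eq_right (by linarith)]
      ring

lemma count_pos (hp2 : p ≠ ∞) {f g : lp (fun _ : I => ℝ) p} (h1 : Majorized f g)
    (h2 : Majorized g f) {a : ℝ} (ha : 0 < a) : Nonempty ({i // f i = a} ≃ {i // g i = a}) := by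
  classical
  obtain ⟨ε₁, he1, hf1⟩ := exists_gap hp2 f ha
  obtain ⟨ε₂, he2, hg2⟩ := exists_gap hp2 g ha
  let ε := min (min ε₁ ε₂) (a / 2)
  have hε : 0 < ε := lt_min (lt_min he1 he2) (half_pos ha)
  have hεa : ε ≤ a / 2 := min_le_right _ _
  have hf : ∀ i, |f i - a| < ε → f i = a := fun i hi =>
    hf1 i (hi.trans_le ((min_le_left _ _).trans (min_le_left _ _)))
  have hg : ∀ i, |g i - a| < ε → g i = a := fun i hi =>
    hg2 i (hi.trans_le ((min_le_left _ _).trans (min_le_right _ _)))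
  have hs : ∀ f : lp (fun _ : I => ℝ) p, (∀ i, |f i - a| < ε → f i = a) →
      ∑' i, max (f i - (a - ε)) 0 - 2 * ∑' i, max (f i - a) 0 + ∑' i, max (f i - (a + ε)) 0
        = Nat.card {i // f i = a} * ε ∧ Finite {i // f i = a} := by
    intro f hf
    have hfin : {i | f i = a}.Finite := by
      refine (finite_gt hp2 f (half_pos ha)).subset fun i hi => ?_
      have hi : f i = a := hi
      show a / 2 < f i
      linarith
    have s1 := (summable_pp hp2 f (by linarith : 0 < a - ε)).hasSum
    have s2 := (summable_pp hp2 f ha).hasSum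
    have s3 := (summable_pp hp2 f (by linarith : 0 < a + ε)).hasSum
    have s4 := (s1.sub (s2.mul_left 2)).add s3
    simp only [fun i => tent hε (hf i)] at s4
    refine ⟨?_, hfin⟩
    have s5 := hasSum_sum_of_ne_finset_zero (f := fun i => if f i = a then ε else 0)
      (L := SummationFilter.unconditional I)
      (s := hfin.toFinset) (fun i hi => by
        have : f i ≠ a := by simpa using hi
        simp [this])
    rw [s4.unique s5]
    rw [Finset.sum_congr rfl (g := fun _ => ε)]
    · rw [Finset.sum_const, nsmul_eq_mul]
      congr 2
      exact (Nat.card_eq_card_finite_toFinset hfin).symm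
    · intro i hi
      have : f i = a := by simpa using hi
      simp [this]
  have e : ∀ t : ℝ, 0 < t → ∑' i, max (f i - t) 0 = ∑' i, max (g i - t) 0 := fun t ht =>
    mutual_eq hp2 h1 h2 (φ := fun x => max (x - t) 0) (SL_pp t) (fun x => le_max_right _ _)
      (summable_pp hp2 g ht)
  have hf' := hs f hf
  have hg' := hs g hg
  rw [e _ (by linarith), e _ ha, e _ (by linarith), hg'.1] at hf'
  have hc : Nat.card {i // g i = a} = Nat.card {i // f i = a} := by
    exact_mod_cast mul_right_cancel₀ hε.ne' hf'.1
  have := hf'.2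
  have := hg'.2
  exact Finite.card_eq.1 hc.symm

lemma maj_neg {f g : lp (fun _ : I => ℝ) p} (h : Majorized f g) : Majorized (-f) (-g) := by
  obtain ⟨D, hD, rfl⟩ := h
  exact ⟨D, hD, by simp⟩

lemma count (hp2 : p ≠ ∞) {f g : lp (fun _ : I => ℝ) p} (h1 : Majorized f g)
    (h2 : Majorized g f) {a : ℝ} (ha : a ≠ 0) : Nonempty ({i // f i = a} ≃ {i // g i = a}) := by
  rcases lt_or_gt_of_ne ha with h | h
  · obtain ⟨e⟩ := count_pos hp2 (maj_neg h1) (maj_neg h2) (a := -a) (by linarith)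
    have E : ∀ f : lp (fun _ : I => ℝ) p, ∀ i, (-f) i = -a ↔ f i = a := fun f i => by simp
    exact ⟨((Equiv.subtypeEquivRight (E f)).symm.trans e).trans (Equiv.subtypeEquivRight (E g))⟩
  · exact count_pos hp2 h1 h2 h

lemma exists_P (hp2 : p ≠ ∞) {σ : I → I} (hσ : Function.Injective σ) :
    ∃ P : lp (fun _ : I => ℝ) p →L[ℝ] lp (fun _ : I => ℝ) p,
      (∀ j, P (stdb p j) = stdb p (σ j)) ∧ ∀ g, ‖P g‖ ≤ ‖g‖ := by
  classical
  have hp := one_le_toReal hp2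
  have e1 : ∀ (g : I → ℝ) s, Function.extend σ g 0 (σ s) = g s := fun g s => hσ.extend_apply _ _ _
  have e2 : ∀ (g : I → ℝ) r, (¬ ∃ s, σ s = r) → Function.extend σ g 0 r = 0 := fun g r hr => by
    rw [Function.extend_apply' _ _ _ hr]; rfl
  have key : ∀ g : lp (fun _ : I => ℝ) p,
      HasSum (fun r => ‖Function.extend σ (fun i => g i) 0 r‖ ^ p.toReal) (‖g‖ ^ p.toReal) := by
    intro g
    rw [← hσ.hasSum_iff]
    · simpa only [Function.comp_def, e1] using lp.hasSum_norm (by linarith) g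
    · intro r hr
      rw [e2 _ r hr, norm_zero, Real.zero_rpow (by linarith)]
  let L : lp (fun _ : I => ℝ) p →ₗ[ℝ] lp (fun _ : I => ℝ) p :=
    { toFun := fun g => ⟨fun r => Function.extend σ (fun i => g i) 0 r, memℓp_gen (key g).summable⟩
      map_add' := fun g h => by
        ext r
        by_cases hr : ∃ s, σ s = r
        · obtain ⟨s, rfl⟩ := hr
          simp only [lp.coeFn_add, Pi.add_apply]
          change Function.extend σ (_ : I → ℝ) (0 : I → ℝ) (σ s) = Function.extend σ (_ : I → ℝ) (0 : I → ℝ) (σ s) +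
            Function.extend σ (_ : I → ℝ) (0 : I → ℝ) (σ s)
          rw [e1, e1, e1]
        · simp only [lp.coeFn_add, Pi.add_apply]
          change Function.extend σ (_ : I → ℝ) (0 : I → ℝ) r = Function.extend σ (_ : I → ℝ) (0 : I → ℝ) r + Function.extend σ (_ : I → ℝ) (0 : I → ℝ) r
          rw [e2 _ r hr, e2 _ r hr, e2 _ r hr, add_zero]
      map_smul' := fun c g => by
        ext r
        by_cases hr : ∃ s, σ s = r
        · obtain ⟨s, rfl⟩ := hr
          simp [e1]
        · simp [e2 _ r hr] }
  have hL : ∀ g, ‖L g‖ ≤ ‖g‖ := fun g =>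
    lp.norm_le_of_tsum_le (by linarith) (norm_nonneg _) (key g).tsum_eq.le
  refine ⟨L.mkContinuous 1 (fun g => by rw [one_mul]; exact hL g), fun j => ?_, hL⟩
  ext r
  change Function.extend σ (fun i => stdb p j i) 0 r = _
  by_cases hr : ∃ s, σ s = r
  · obtain ⟨s, rfl⟩ := hr
    rw [e1, stdb_apply, stdb_apply]
    simp [hσ.eq_iff]
  · rw [e2 _ r hr, stdb_apply, if_neg]
    rintro rfl
    exact hr ⟨j, rfl⟩

lemma summable_ops (hp2 : p ≠ ∞) {ι : Type*} (α : ι → ℝ) (hα : Memℓp α p) (σ : ι → I → I)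
    (P : ι → lp (fun _ : I => ℝ) p →L[ℝ] lp (fun _ : I => ℝ) p)
    (hdis : ∀ i j s t, σ i s = σ j t → i = j)
    (hP : ∀ i j, P i (stdb p j) = stdb p (σ i j)) (hPn : ∀ i g, ‖P i g‖ ≤ ‖g‖) :
    Summable (fun i => α i • P i) := by
  classical
  have hp := one_le_toReal hp2
  have hp0 : 0 < p.toReal := by linarith
  have hb : ∀ F : Finset ι, ‖∑ i ∈ F, α i • P i‖ ≤
      (∑ i ∈ F, ‖α i‖ ^ p.toReal) ^ (1 / p.toReal) := by
    intro F
    refine ContinuousLinearMap.opNorm_le_bound _ (by positivity) fun g => ?_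
    refine lp.norm_le_of_tsum_le hp0 (by positivity) ?_
    have hc : ((∑ i ∈ F, ‖α i‖ ^ p.toReal) ^ (1 / p.toReal) * ‖g‖) ^ p.toReal =
        ∑ i ∈ F, ‖α i‖ ^ p.toReal * ‖g‖ ^ p.toReal := by
      rw [Real.mul_rpow (by positivity) (norm_nonneg _), ← Real.rpow_mul (by positivity),
        one_div_mul_cancel hp0.ne', Real.rpow_one, Finset.sum_mul]
    rw [hc]
    have hs : HasSum (fun r => ∑ i ∈ F, ‖α i‖ ^ p.toReal * ‖P i g r‖ ^ p.toReal)
        (∑ i ∈ F, ‖α i‖ ^ p.toReal * ‖P i g‖ ^ p.toReal) :=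
      hasSum_sum fun i _ => (lp.hasSum_norm hp0 (P i g)).mul_left _
    have hv : ∀ r, (∑ i ∈ F, α i • P i) g r = ∑ i ∈ F, α i * P i g r := by
      intro r
      rw [← ev_apply (p := p) r, _root_.sum_apply, map_sum]
      rfl
    have hle : ∀ r, ‖(∑ i ∈ F, α i • P i) g r‖ ^ p.toReal ≤
        ∑ i ∈ F, ‖α i‖ ^ p.toReal * ‖P i g r‖ ^ p.toReal := by
      intro r
      rw [hv]
      by_cases h : ∃ k ∈ F, ∃ s, r = σ k s
      · obtain ⟨k, hk, s, rfl⟩ := h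
        rw [Finset.sum_eq_single_of_mem k hk]
        · rw [norm_mul, Real.mul_rpow (norm_nonneg _) (norm_nonneg _)]
          exact Finset.single_le_sum
            (f := fun i => ‖α i‖ ^ p.toReal * ‖P i g (σ k s)‖ ^ p.toReal)
            (fun i _ => by positivity) hk
        · intro i _ hik
          rw [P_apply_not hp2 (hP i) g _ fun t ht => hik (hdis _ _ _ _ ht).symm, mul_zero]
      · rw [Finset.sum_eq_zero, norm_zero, Real.zero_rpow hp0.ne']
        · positivity
        · intro i hi
          rw [P_apply_not hp2 (hP i) g _ fun t ht => h ⟨i, hi, t, ht⟩, mul_zero]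
    calc _ ≤ _ := ((lp.memℓp _).summable hp0).tsum_le_tsum hle hs.summable
      _ = _ := hs.tsum_eq
      _ ≤ _ := Finset.sum_le_sum fun i _ => by
        have := hPn i g
        gcongr
  rw [summable_iff_vanishing_norm]
  intro ε hε
  obtain ⟨s, hs⟩ := summable_iff_vanishing_norm.1 (hα.summable hp0) (ε ^ p.toReal) (by positivity)
  refine ⟨s, fun t ht => (hb t).trans_lt ?_⟩
  have h := (le_abs_self _).trans_lt (hs t ht)
  calc _ < (ε ^ p.toReal) ^ (1 / p.toReal) :=
        Real.rpow_lt_rpow (by positivity) h (by positivity)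
    _ = ε := by rw [← Real.rpow_mul hε.le, mul_one_div_cancel hp0.ne', Real.rpow_one]

lemma forward [Infinite I] (hp1 : 1 < p) (hp2 : p ≠ ∞)
    (T : lp (fun _ : I => ℝ) p →L[ℝ] lp (fun _ : I => ℝ) p) (hT : PreservesMajorization T) :
      ∃ (I₀ : Set I) (α : I₀ → ℝ) (σ : I₀ → I → I)
        (P : I₀ → lp (fun _ : I => ℝ) p →L[ℝ] lp (fun _ : I => ℝ) p),
        I₀.Countable ∧ Memℓp α p ∧
        (∀ i, Function.Injective (σ i)) ∧
        (∀ i₁ i₂ : I₀, i₁ ≠ i₂ → Disjoint (Set.range (σ i₁)) (Set.range (σ i₂))) ∧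
        (∀ (i : I₀) (j : I), P i (stdb p j) = stdb p (σ i j)) ∧
        HasSum (fun i : I₀ => α i • P i) T := by
  classical
  have hp := one_le_toReal hp2
  have hp0 : 0 < p.toReal := by linarith
  obtain ⟨j₀⟩ : Nonempty I := inferInstance
  have hmaj : ∀ j k, Majorized (T (stdb p j)) (T (stdb p k)) := fun j k => by
    refine hT _ _ (perm_maj hp2 (Equiv.swap j k) _ _ fun l => ?_)
    rw [stdb_apply, stdb_apply]
    congr 1
    rw [Equiv.swap_apply_eq_iff]; simp
  have hE : ∀ j (a : ℝ), a ≠ 0 →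
      Nonempty ({i // T (stdb p j₀) i = a} ≃ {i // T (stdb p j) i = a}) := fun j a ha =>
    count hp2 (hmaj _ _) (hmaj _ _) ha
  let I₀ : Set I := {i | T (stdb p j₀) i ≠ 0}
  let α : I₀ → ℝ := fun i => T (stdb p j₀) i
  have hs : ∀ j, ∃ s : I₀ → I, Function.Injective s ∧ (∀ i, T (stdb p j) (s i) = α i) ∧
      ∀ r, T (stdb p j) r ≠ 0 → ∃ i, s i = r := by
    intro j
    let E := fun a ha => Classical.choice (hE j a ha)
    have hval : ∀ a ha x, T (stdb p j) (E a ha x).1 = a := fun a ha x => (E a ha x).2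
    refine ⟨fun i => (E (α i) i.2 ⟨i, rfl⟩).1, ?_, fun i => hval (α i) i.2 ⟨i, rfl⟩, ?_⟩
    · intro i i' h
      simp only at h
      have hα : α i = α i' := by
        rw [← hval (α i) i.2 ⟨i, rfl⟩, ← hval (α i') i'.2 ⟨i', rfl⟩, h]
      have aux : ∀ a b ha hb (x : {i // T (stdb p j₀) i = a}) (y : {i // T (stdb p j₀) i = b}),
          a = b → (E a ha x).1 = (E b hb y).1 → x.1 = y.1 := by
        rintro a b ha hb x y rfl hxy
        rw [(E a ha).injective (Subtype.ext hxy)]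
      exact Subtype.ext (aux (α i) (α i') i.2 i'.2 ⟨i, rfl⟩ ⟨i', rfl⟩ hα h)
    · intro r hr
      obtain ⟨x, hx⟩ := (E _ hr).surjective ⟨r, rfl⟩
      have hxa : T (stdb p j₀) x.1 = T (stdb p j) r := x.2
      refine ⟨⟨x.1, fun h0 => hr (hxa ▸ h0)⟩, ?_⟩
      have aux : ∀ a b ha hb (x : {i // T (stdb p j₀) i = a}) (y : {i // T (stdb p j₀) i = b}),
          a = b → x.1 = y.1 → (E a ha x).1 = (E b hb y).1 := by
        rintro a b ha hb x y rfl hxy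
        rw [Subtype.ext hxy]
      exact (aux (T (stdb p j₀) x.1) _ (fun h0 => hr (hxa ▸ h0)) hr ⟨x.1, rfl⟩ x hxa rfl).trans (congrArg Subtype.val hx)
  choose s hsinj hsval hssurj using hs
  have hinter : ∀ i i' j j', s j i = s j' i' → j = j' ∧ i = i' := by
    intro i i' j j' h
    have hj : j = j' := by
      by_contra hne
      refine disjoint_cols hp1 hp2 T hT (i := j) (k₀ := j') (Ne.symm hne) (s j i) ?_ ?_
      · rw [hsval]; exact i.2
      · rw [h, hsval]; exact i'.2
    subst hj
    exact ⟨rfl, hsinj j h⟩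
  have hσ : ∀ i, Function.Injective (fun j => s j i) := fun i j j' h => (hinter _ _ _ _ h).1
  choose P hP hPn using fun i => exists_P (p := p) hp2 (hσ i)
  have hα : Memℓp α p := by
    rw [memℓp_gen_iff hp0]
    exact ((lp.memℓp (T (stdb p j₀))).summable hp0).comp_injective
      (i := fun i : I₀ => (i : I)) Subtype.val_injective
  have hsum : Summable (fun i => α i • P i) :=
    summable_ops hp2 α hα (fun i j => s j i) P (fun i i' j j' h => (hinter _ _ _ _ h).2) hP hPn
  have hTeq : ∑' i, α i • P i = T := by
    refine ext_stdb hp2 fun j => ?_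
    ext r
    have h := sum_apply hsum.hasSum (stdb p j) r
    refine h.unique ?_
    have hterm : ∀ i, (α i • P i) (stdb p j) r = α i * (if r = s j i then 1 else 0) := by
      intro i
      have : (α i • P i) (stdb p j) r = α i * P i (stdb p j) r := rfl
      rw [this, hP, stdb_apply]
    simp only [hterm]
    by_cases hr : T (stdb p j) r = 0
    · rw [hr]
      convert hasSum_zero using 2 with i
      rw [if_neg, mul_zero]
      rintro rfl
      rw [hsval] at hr
      exact i.2 hr
    · obtain ⟨i, rfl⟩ := hssurj j r hr
      convert hasSum_single i ?_ using 1
      · rw [hsval]; simp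
      · intro k hk
        rw [if_neg, mul_zero]
        exact fun h => hk (hsinj j h).symm
  refine ⟨I₀, α, fun i j => s j i, P, ?_, hα, hσ, ?_, hP, hTeq ▸ hsum.hasSum⟩
  · refine ((lp.memℓp (T (stdb p j₀))).summable hp0).countable_support.mono fun i hi => ?_
    have hi : T (stdb p j₀) i ≠ 0 := hi
    simp only [Function.mem_support]
    exact (Real.rpow_pos_of_pos (norm_pos_iff.2 hi) _).ne'
  · intro i i' hne
    rw [Set.disjoint_left]
    rintro _ ⟨j, rfl⟩ ⟨j', hj⟩
    exact hne (hinter _ _ _ _ hj).2.symm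

end S19

/-- For `I` infinite and `1 < p < ∞`, a bounded operator `T` on `ℓᵖ(I)` preserves majorization
iff `T = ∑_{i∈I₀} α i • P_{σ i}` for a countable `I₀`, `(α i) ∈ ℓᵖ(I₀)`, and injections
`σ i : I → I` with pairwise disjoint ranges (series converging in operator norm). -/
theorem stmt19 {I : Type*} [Infinite I] (p : ℝ≥0∞) [Fact (1 ≤ p)] (hp1 : 1 < p) (hp2 : p ≠ ∞)
    (T : lp (fun _ : I => ℝ) p →L[ℝ] lp (fun _ : I => ℝ) p) :
    PreservesMajorization T ↔
      ∃ (I₀ : Set I) (α : I₀ → ℝ) (σ : I₀ → I → I)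
        (P : I₀ → lp (fun _ : I => ℝ) p →L[ℝ] lp (fun _ : I => ℝ) p),
        I₀.Countable ∧ Memℓp α p ∧
        (∀ i, Function.Injective (σ i)) ∧
        (∀ i₁ i₂ : I₀, i₁ ≠ i₂ → Disjoint (Set.range (σ i₁)) (Set.range (σ i₂))) ∧
        (∀ (i : I₀) (j : I), P i (stdb p j) = stdb p (σ i j)) ∧
        HasSum (fun i : I₀ => α i • P i) T := by

  constructor
  · exact S19.forward hp1 hp2 T
  · rintro ⟨I₀, α, σ, P, -, -, hσ, hdis, hP, hT⟩
    refine S19.backward hp2 α σ P T hσ (fun i j s t h => ?_) hP hT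
    by_contra hne
    exact Set.disjoint_left.1 (hdis i j hne) ⟨s, rfl⟩ ⟨t, h.symm⟩
end
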